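/- arXiv:2503.20106 — 2 statements merged into one kernel-verified Lean document; each statement's English description precedes it below -/
import Mathlib

section
/- Let G be a 2-edge-connected graph, and let e be a non-loop edge of G. Then G has a cc-minor H that is the parallel connection, with basepoint e, of a collection of cycles each containing e. -/
open scoped Classical

noncomputable section

/-- A finite multigraph with vertices and edge names drawn from `ℕ`.
Each edge name `e ∈ E` has a pair of (possibly equal) endpoints `ends e`. -/
structure MGraph where
  V : Finset ℕ
  E : Finset ℕ
  ends : ℕ → Sym2 ℕ
  ends_mem : ∀ e ∈ E, ∀ v ∈ ends e, v ∈ V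

namespace MGraph

/-- Adjacency via some edge. -/
def Adj (G : MGraph) (u v : ℕ) : Prop := ∃ e ∈ G.E, G.ends e = s(u, v)

/-- Reachability. -/
def Reach (G : MGraph) : ℕ → ℕ → Prop := Relation.ReflTransGen G.Adj

/-- A graph is connected if it has a vertex and all vertices are mutually reachable. -/
def Connected (G : MGraph) : Prop :=
  G.V.Nonempty ∧ ∀ u ∈ G.V, ∀ v ∈ G.V, G.Reach u v

/-- Delete a set of edges. -/
def deleteEdges (G : MGraph) (Z : Finset ℕ) : MGraph where
  V := G.V
  E := G.E \ Z
  ends := G.ends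
  ends_mem := fun e he => G.ends_mem e (Finset.mem_sdiff.mp he).1

/-- A graph with at least two vertices is `k`-edge-connected if deleting any
set of fewer than `k` edges leaves it connected. -/
def EdgeConnected (G : MGraph) (k : ℕ) : Prop :=
  2 ≤ G.V.card ∧ ∀ Z ⊆ G.E, Z.card < k → (G.deleteEdges Z).Connected

/-- A graph is loopless if no edge has equal endpoints. -/
def Loopless (G : MGraph) : Prop := ∀ e ∈ G.E, ¬ (G.ends e).IsDiag

/-- The set of vertices met by an edge set. -/
def vertsOf (G : MGraph) (C : Finset ℕ) : Finset ℕ :=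
  G.V.filter (fun v => ∃ e ∈ C, v ∈ G.ends e)

/-- Degree of `v` in the edge set `C` (loops counted twice). -/
def degIn (G : MGraph) (C : Finset ℕ) (v : ℕ) : ℕ :=
  ∑ e ∈ C, (if G.ends e = s(v, v) then 2 else if v ∈ G.ends e then 1 else 0)

/-- `C` is the edge set of a cycle of `G`: a nonempty connected edge set in which
every vertex met has degree exactly two (a loop and a pair of parallel edges are cycles). -/
def IsCycleSet (G : MGraph) (C : Finset ℕ) : Prop :=
  C.Nonempty ∧ C ⊆ G.E ∧
  (∀ v ∈ G.vertsOf C, G.degIn C v = 2) ∧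
  ∀ u ∈ G.vertsOf C, ∀ v ∈ G.vertsOf C,
    Relation.ReflTransGen (fun a b => ∃ e ∈ C, G.ends e = s(a, b)) u v

/-- The vertex map identifying all vertices of `U` (within `G.V`) to a single one. -/
def cmapOn (G : MGraph) (U : Finset ℕ) : ℕ → ℕ :=
  fun v => if v ∈ U ∩ G.V then sInf {w : ℕ | w ∈ U ∩ G.V} else v

/-- Contract the vertex set `U` to a single vertex, deleting the edges of `S` and all
newly created loops (edges with both ends in `U` that were not already loops), while
keeping pre-existing loops not in `S`. -/
def contractOn (G : MGraph) (U S : Finset ℕ) : MGraph where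
  V := G.V.image (G.cmapOn U)
  E := G.E.filter (fun e => ¬ (∀ v ∈ G.ends e, v ∈ U) ∨ ((G.ends e).IsDiag ∧ e ∉ S))
  ends := fun e => (G.ends e).map (G.cmapOn U)
  ends_mem := by
    intro e he v hv
    have he' : e ∈ G.E := (Finset.mem_filter.mp he).1
    rw [Sym2.mem_map] at hv
    obtain ⟨w, hw, rfl⟩ := hv
    have hwV : w ∈ G.V := G.ends_mem e he' w hw
    by_cases h : w ∈ U ∩ G.V
    · have hmem : sInf {x : ℕ | x ∈ U ∩ G.V} ∈ U ∩ G.V := Nat.sInf_mem ⟨w, h⟩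
      refine Finset.mem_image.mpr ⟨sInf {x : ℕ | x ∈ U ∩ G.V},
        (Finset.mem_inter.mp hmem).2, ?_⟩
      simp [cmapOn, h, hmem]
    · exact Finset.mem_image.mpr ⟨w, hwV, by simp [cmapOn, h]⟩

/-- Contract a cycle (given by its edge set), deleting all created loops. -/
def contractCycle (G : MGraph) (C : Finset ℕ) : MGraph :=
  G.contractOn (G.vertsOf C) C

/-- `H` is a cycle-contraction minor (cc-minor) of `G`: `H` is obtained from `G` by
a sequence of cycle contractions (each accompanied by contraction of created loops). -/
def CCMinor (G H : MGraph) : Prop :=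
  Relation.ReflTransGen (fun A B => ∃ C, A.IsCycleSet C ∧ B = A.contractCycle C) G H

/-- Walks: a vertex list together with a matching edge list. -/
inductive IsWalk (G : MGraph) : List ℕ → List ℕ → Prop
  | nil {v : ℕ} (hv : v ∈ G.V) : IsWalk G [v] []
  | cons {u v : ℕ} {e : ℕ} {vs es : List ℕ} (he : e ∈ G.E)
      (hends : G.ends e = s(u, v)) (hw : IsWalk G (v :: vs) es) :
      IsWalk G (u :: v :: vs) (e :: es)

/-- A path from `u` to `v`, given by its vertex list and edge list. -/
def IsPathBetween (G : MGraph) (u v : ℕ) (vs es : List ℕ) : Prop :=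
  G.IsWalk vs es ∧ vs.Nodup ∧ vs.head? = some u ∧ vs.getLast? = some v

/-- `G` is `k`-connected: it has at least `k` vertices and any two distinct vertices are
joined by at least `k` pairwise internally disjoint paths. -/
def KConnected (G : MGraph) (k : ℕ) : Prop :=
  k ≤ G.V.card ∧ ∀ u ∈ G.V, ∀ v ∈ G.V, u ≠ v →
    ∃ P : Fin k → List ℕ × List ℕ,
      (∀ i, G.IsPathBetween u v (P i).1 (P i).2) ∧
      ∀ i j, i ≠ j →
        (∀ x, x ∈ (P i).1 → x ∈ (P j).1 → x = u ∨ x = v) ∧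
        (∀ e, e ∈ (P i).2 → e ∉ (P j).2)

/-- A simple graph: no loops and no parallel edges. -/
def Simple (G : MGraph) : Prop :=
  G.Loopless ∧ ∀ e ∈ G.E, ∀ f ∈ G.E, G.ends e = G.ends f → e = f

/-- Graph isomorphism. -/
def Iso (G H : MGraph) : Prop :=
  ∃ φ ψ : ℕ → ℕ, Set.BijOn φ ↑G.V ↑H.V ∧ Set.BijOn ψ ↑G.E ↑H.E ∧
    ∀ e ∈ G.E, H.ends (ψ e) = (G.ends e).map φ

/-- The bond graph `B n`: two vertices joined by `n` parallel edges. -/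
def IsBondGraph (H : MGraph) (n : ℕ) : Prop :=
  ∃ u v : ℕ, u ≠ v ∧ H.V = {u, v} ∧ H.E.card = n ∧ ∀ e ∈ H.E, H.ends e = s(u, v)

end MGraph

namespace MGraph

/-- `F` is a subgraph of `G`. -/
def IsSubgraph (F G : MGraph) : Prop :=
  F.V ⊆ G.V ∧ F.E ⊆ G.E ∧ ∀ e ∈ F.E, F.ends e = G.ends e

end MGraph

/-- `H` is the parallel connection, with basepoint `e`, of a collection of cycles each
containing `e`. -/
def IsParallelConnOfCycles (H : MGraph) (e : ℕ) : Prop :=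
  ∃ u v : ℕ, u ≠ v ∧ e ∈ H.E ∧ H.ends e = s(u, v) ∧
    ∃ (n : ℕ) (Cs : Fin n → Finset ℕ), 0 < n ∧
      (∀ i, H.IsCycleSet (Cs i) ∧ e ∈ Cs i) ∧
      (∀ i j, i ≠ j → Cs i ∩ Cs j = {e} ∧ H.vertsOf (Cs i) ∩ H.vertsOf (Cs j) = {u, v}) ∧
      H.E = (Finset.univ : Finset (Fin n)).biUnion Cs ∧
      H.V = (Finset.univ : Finset (Fin n)).biUnion (fun i => H.vertsOf (Cs i))

namespace MGraph

/-- `a` and `b` are joined by an edge of `C`. -/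
def Link (G : MGraph) (C : Finset ℕ) (a b : ℕ) : Prop := ∃ e ∈ C, G.ends e = s(a, b)

/-- `P` is the edge set, and `S` the vertex set, of a path of `G` from `x` to `y`. -/
inductive IsPathSet (G : MGraph) : ℕ → ℕ → Finset ℕ → Finset ℕ → Prop
  | nil {x : ℕ} (hx : x ∈ G.V) : IsPathSet G x x {x} ∅
  | cons {w x y f : ℕ} {S P : Finset ℕ} (hf : f ∈ G.E) (hends : G.ends f = s(w, x))
      (hw : w ∉ S) (h : IsPathSet G x y S P) : IsPathSet G w y (insert w S) (insert f P)

variable {G : MGraph} {C D P Q S T : Finset ℕ} {e f u v w x y z : ℕ}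

lemma Link.symm (h : G.Link C x y) : G.Link C y x := by
  obtain ⟨f, hf, hxy⟩ := h
  exact ⟨f, hf, hxy.trans Sym2.eq_swap⟩

lemma reflTransGen_link_symm (h : Relation.ReflTransGen (G.Link C) x y) :
    Relation.ReflTransGen (G.Link C) y x :=
  have : Std.Symm (G.Link C) := ⟨fun _ _ => Link.symm⟩
  Relation.ReflTransGen.stdSymm.symm _ _ h

lemma reflTransGen_link_mono (hCD : C ⊆ D) (h : Relation.ReflTransGen (G.Link C) x y) :
    Relation.ReflTransGen (G.Link D) x y :=
  Relation.ReflTransGen.mono (fun _ _ ⟨f, hf, hxy⟩ => ⟨f, hCD hf, hxy⟩) _ _ h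

lemma mem_V_of_ends (hf : f ∈ G.E) (h : G.ends f = s(x, y)) : x ∈ G.V ∧ y ∈ G.V :=
  ⟨G.ends_mem f hf x (by simp [h]), G.ends_mem f hf y (by simp [h])⟩

namespace IsPathSet

lemma left_mem (h : G.IsPathSet x y S P) : x ∈ S := by
  cases h <;> simp

lemma right_mem (h : G.IsPathSet x y S P) : y ∈ S := by
  induction h with
  | nil hx => simp
  | cons hf hends hw h ih => exact Finset.mem_insert_of_mem ih

lemma subset_V (h : G.IsPathSet x y S P) : S ⊆ G.V := by
  induction h with
  | nil hx => simpa using hx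
  | cons hf hends hw h ih =>
    exact Finset.insert_subset (mem_V_of_ends hf hends).1 ih

lemma subset_E (h : G.IsPathSet x y S P) : P ⊆ G.E := by
  induction h with
  | nil hx => simp
  | cons hf hends hw h ih => exact Finset.insert_subset hf ih

lemma mem_of_mem_ends (h : G.IsPathSet x y S P) (hf : f ∈ P) (hz : z ∈ G.ends f) : z ∈ S := by
  induction h with
  | nil hx => simp at hf
  | cons hg hends hw h ih =>
    rcases Finset.mem_insert.1 hf with rfl | hf
    · rw [hends, Sym2.mem_iff] at hz
      rcases hz with rfl | rfl
      · simp
      · exact Finset.mem_insert_of_mem h.left_mem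
    · exact Finset.mem_insert_of_mem (ih hf)

lemma reach (h : G.IsPathSet x y S P) (hz : z ∈ S) : Relation.ReflTransGen (G.Link P) x z := by
  induction h with
  | nil hx =>
    rw [Finset.mem_singleton.1 hz]
  | @cons w x y f S P hf hends hw h ih =>
    rcases Finset.mem_insert.1 hz with rfl | hz
    · exact .refl
    · exact .head ⟨f, by simp, hends⟩ (reflTransGen_link_mono (by simp) (ih hz))

lemma degIn_add (h : G.IsPathSet x y S P) (z : ℕ) :
    G.degIn P z + ((if z = x then 1 else 0) + (if z = y then 1 else 0)) =
      if z ∈ S then 2 else 0 := by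
  induction h with
  | @nil x hx => by_cases hz : z = x <;> simp [degIn, hz]
  | @cons w x y f S P hf hends hw h ih =>
    have hfP : f ∉ P := fun hfP => hw (h.mem_of_mem_ends hfP (by simp [hends]))
    have hwx : w ≠ x := fun hwx => hw (hwx ▸ h.left_mem)
    have hwy : w ≠ y := fun hwy => hw (hwy ▸ h.right_mem)
    have hxS := h.left_mem
    rw [degIn, Finset.sum_insert hfP, ← degIn, hends]
    by_cases hzw : z = w
    · subst hzw
      simp [hw, hwx, hwy] at ih ⊢
      simp [ih, hwx.symm]
    · by_cases hzx : z = x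
      · subst hzx
        simp [hzw, hxS, Ne.symm hzw] at ih ⊢
        omega
      · simp [hzw, hzx, Ne.symm hzw] at ih ⊢
        exact ih

lemma vertsOf_insert (h : G.IsPathSet x y S P) (hends : G.ends f = s(x, y)) :
    G.vertsOf (insert f P) = S := by
  ext z
  simp only [vertsOf, Finset.mem_filter]
  constructor
  · rintro ⟨-, g, hg, hz⟩
    rcases Finset.mem_insert.1 hg with rfl | hg
    · rw [hends, Sym2.mem_iff] at hz
      rcases hz with rfl | rfl
      exacts [h.left_mem, h.right_mem]
    · exact h.mem_of_mem_ends hg hz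
  · intro hz
    refine ⟨h.subset_V hz, ?_⟩
    rcases Relation.ReflTransGen.cases_tail (h.reach hz) with rfl | ⟨b, -, g, hg, hbz⟩
    · exact ⟨f, by simp, by simp [hends]⟩
    · exact ⟨g, by simp [hg], by simp [hbz]⟩

lemma isCycleSet_insert (h : G.IsPathSet x y S P) (hf : f ∈ G.E) (hfP : f ∉ P)
    (hends : G.ends f = s(x, y)) : G.IsCycleSet (insert f P) := by
  refine ⟨by simp, Finset.insert_subset hf h.subset_E, ?_, ?_⟩
  · intro z hz
    rw [h.vertsOf_insert hends] at hz
    have := h.degIn_add z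
    rw [degIn, Finset.sum_insert hfP, ← degIn, hends]
    rw [if_pos hz] at this
    rw [← this, add_comm (degIn G P z)]
    congr 1
    by_cases hzx : z = x <;> by_cases hzy : z = y <;> simp [hzx, hzy] <;> grind
  · rw [h.vertsOf_insert hends]
    intro a ha b hb
    exact reflTransGen_link_mono (Finset.subset_insert _ _)
      ((reflTransGen_link_symm (h.reach ha)).trans (h.reach hb))

lemma exists_split (h : G.IsPathSet x y S P) (hw : w ∈ S) :
    ∃ S₁ P₁ S₂ P₂, G.IsPathSet x w S₁ P₁ ∧ G.IsPathSet w y S₂ P₂ ∧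
      (∀ z ∈ S₁, z ∈ S₂ → z = w) ∧ S = S₁ ∪ S₂ ∧ P = P₁ ∪ P₂ := by
  induction h with
  | @nil x hx =>
    obtain rfl := Finset.mem_singleton.1 hw
    exact ⟨{w}, ∅, {w}, ∅, .nil hx, .nil hx, by simp, by simp, by simp⟩
  | @cons a x y f S P hf hends ha h ih =>
    by_cases hwa : w = a
    · subst hwa
      refine ⟨{w}, ∅, _, _, .nil (mem_V_of_ends hf hends).1, .cons hf hends ha h, by simp,
        by simp, by simp⟩
    · obtain ⟨S₁, P₁, S₂, P₂, h₁, h₂, hS, rfl, rfl⟩ := ih (by grind)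
      refine ⟨insert a S₁, insert f P₁, S₂, P₂, .cons hf hends (by grind) h₁, h₂, by grind,
        by grind, by grind⟩

lemma append {S₁ S₂ P₁ P₂ : Finset ℕ} (h₁ : G.IsPathSet x w S₁ P₁) (h₂ : G.IsPathSet w y S₂ P₂)
    (h : ∀ z ∈ S₁, z ∈ S₂ → z = w) : G.IsPathSet x y (S₁ ∪ S₂) (P₁ ∪ P₂) := by
  induction h₁ with
  | @nil x hx =>
    have : {x} ∪ S₂ = S₂ := by simpa using h₂.left_mem
    simpa [this] using h₂
  | @cons a x w f S P hf hends ha h₁ ih =>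
    have hwS := h₁.right_mem
    rw [Finset.insert_union, Finset.insert_union]
    have haw : a ≠ w := fun h => ha (h ▸ hwS)
    exact .cons hf hends (by grind) (ih h₂ (by grind))

lemma single (hf : f ∈ G.E) (hends : G.ends f = s(x, y)) (hxy : x ≠ y) :
    G.IsPathSet x y {x, y} {f} := by
  simpa using IsPathSet.cons hf hends (by simpa) (.nil (mem_V_of_ends hf hends).2)

lemma symm (h : G.IsPathSet x y S P) : G.IsPathSet y x S P := by
  induction h with
  | nil hx => exact .nil hx
  | @cons a x y f S P hf hends ha h ih =>
    have hxS := h.left_mem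
    have hax : x ≠ a := fun hax => ha (hax ▸ hxS)
    have := ih.append (single hf (hends.trans Sym2.eq_swap) hax) (by grind)
    rwa [show S ∪ {x, a} = insert a S by grind, show P ∪ {f} = insert f P by grind] at this

lemma eq_empty (h : G.IsPathSet x x S P) : P = ∅ := by
  cases h with
  | nil hx => rfl
  | cons hf hends hw h => exact absurd h.right_mem hw

lemma eq_singleton (h : G.IsPathSet x y S P) (hf : f ∈ P) (hends : G.ends f = s(x, y)) :
    P = {f} := by
  cases h with
  | nil hx => simp at hf
  | @cons _ a _ g S P hg hgends hw h =>
    rcases Finset.mem_insert.1 hf with rfl | hf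
    · obtain rfl : a = y := by
        have := hgends.symm.trans hends
        grind
      simp [h.eq_empty]
    · exact absurd (h.mem_of_mem_ends hf (by simp [hends])) hw

lemma not_isDiag (h : G.IsPathSet x y S P) (hf : f ∈ P) : ¬ (G.ends f).IsDiag := by
  induction h with
  | nil hx => simp at hf
  | cons hg hends hw h ih =>
    rcases Finset.mem_insert.1 hf with rfl | hf
    · rw [hends, Sym2.mk_isDiag_iff]
      rintro rfl
      exact hw h.left_mem
    · exact ih hf

lemma exists_reach_erase (h : G.IsPathSet x y S P) (hf : f ∈ P) :
    ∃ a b, G.ends f = s(a, b) ∧ Relation.ReflTransGen (G.Link (P.erase f)) x a ∧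
      Relation.ReflTransGen (G.Link (P.erase f)) b y := by
  induction h with
  | nil hx => simp at hf
  | @cons w x y g S P hg hends hw h ih =>
    have hgP : g ∉ P := fun hgP => hw (h.mem_of_mem_ends hgP (by simp [hends]))
    by_cases hfg : f = g
    · subst hfg
      refine ⟨w, x, hends, .refl, ?_⟩
      rw [Finset.erase_insert hgP]
      exact h.reach h.right_mem
    · obtain ⟨a, b, hab, hxa, hby⟩ := ih (by grind)
      have hsub : P.erase f ⊆ (insert g P).erase f :=
        Finset.erase_subset_erase _ (Finset.subset_insert _ _)
      exact ⟨a, b, hab, .head ⟨g, by grind, hends⟩ (reflTransGen_link_mono hsub hxa),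
        reflTransGen_link_mono hsub hby⟩

end IsPathSet

lemma exists_isPathSet_of_reach (hC : C ⊆ G.E) (hy : y ∈ G.V)
    (h : Relation.ReflTransGen (G.Link C) x y) : ∃ S P, G.IsPathSet x y S P ∧ P ⊆ C := by
  induction h using Relation.ReflTransGen.head_induction_on with
  | refl => exact ⟨_, _, .nil hy, by simp⟩
  | @head a b hab _ ih =>
    obtain ⟨S, P, h, hPC⟩ := ih
    obtain ⟨f, hf, hends⟩ := hab
    by_cases ha : a ∈ S
    · obtain ⟨_, _, S₂, P₂, -, h₂, -, -, rfl⟩ := h.exists_split ha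
      exact ⟨S₂, P₂, h₂, Finset.union_subset_right hPC⟩
    · exact ⟨_, _, .cons (hC hf) hends ha h, Finset.insert_subset hf hPC⟩

lemma exists_isCycleSet_of_mem_of_notMem (h : G.IsPathSet x y S P) (h' : G.IsPathSet x y T Q)
    (hf : f ∈ P) (hfQ : f ∉ Q) : ∃ C, G.IsCycleSet C ∧ C ⊆ P ∪ Q := by
  obtain ⟨a, b, hab, hxa, hby⟩ := h.exists_reach_erase hf
  have hE : (P ∪ Q).erase f ⊆ G.E :=
    (Finset.erase_subset _ _).trans (Finset.union_subset h.subset_E h'.subset_E)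
  have h₁ : P.erase f ⊆ (P ∪ Q).erase f := by grind
  have h₂ : Q ⊆ (P ∪ Q).erase f := by grind
  obtain ⟨R, K, hK, hKsub⟩ := exists_isPathSet_of_reach hE
    (mem_V_of_ends (h.subset_E hf) hab).2
    (((reflTransGen_link_symm (reflTransGen_link_mono h₁ hxa)).trans
      (reflTransGen_link_mono h₂ (h'.reach h'.right_mem))).trans
      (reflTransGen_link_symm (reflTransGen_link_mono h₁ hby)))
  exact ⟨insert f K, hK.isCycleSet_insert (h.subset_E hf) (by grind) hab, by grind⟩

/-- Two distinct paths with the same ends contain a cycle. -/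
lemma exists_isCycleSet_of_ne (h : G.IsPathSet x y S P) (h' : G.IsPathSet x y T Q)
    (hPQ : P ≠ Q) : ∃ C, G.IsCycleSet C ∧ C ⊆ P ∪ Q := by
  by_cases hsub : P ⊆ Q
  · obtain ⟨f, hfQ, hfP⟩ := Finset.exists_of_ssubset (hsub.ssubset_of_ne hPQ)
    rw [Finset.union_comm]
    exact exists_isCycleSet_of_mem_of_notMem h' h hfQ hfP
  · obtain ⟨f, hfP, hfQ⟩ := Finset.not_subset.1 hsub
    exact exists_isCycleSet_of_mem_of_notMem h h' hfP hfQ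

/-- Every cycle avoiding the edge `e` meets both ends of `e`. -/
def CyclesMeetEnds (G : MGraph) (e : ℕ) : Prop :=
  ∀ C, G.IsCycleSet C → e ∉ C → ∀ z ∈ G.ends e, z ∈ G.vertsOf C

lemma CyclesMeetEnds.eq_of_notMem (hG : G.CyclesMeetEnds e) (hz : z ∈ G.ends e)
    (h : G.IsPathSet x y S P) (h' : G.IsPathSet x y T Q) (hP : e ∉ P) (hQ : e ∉ Q)
    (hzS : z ∉ S) (hzT : z ∉ T) : P = Q := by
  by_contra hPQ
  obtain ⟨C, hC, hsub⟩ := exists_isCycleSet_of_ne h h' hPQ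
  have := hG C hC (by grind) z hz
  obtain ⟨-, g, hg, hzg⟩ := Finset.mem_filter.1 this
  rcases Finset.mem_union.1 (hsub hg) with hg | hg
  exacts [hzS (h.mem_of_mem_ends hg hzg), hzT (h'.mem_of_mem_ends hg hzg)]

/-- Two paths joining the ends of `e` that share an inner vertex coincide. -/
lemma CyclesMeetEnds.eq_of_inner_mem (hG : G.CyclesMeetEnds e) (he : G.ends e = s(u, v))
    (h : G.IsPathSet u v S P) (h' : G.IsPathSet u v T Q) (hP : e ∉ P) (hQ : e ∉ Q)
    (hwS : w ∈ S) (hwT : w ∈ T) (hwu : w ≠ u) (hwv : w ≠ v) : P = Q := by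
  obtain ⟨S₁, P₁, S₂, P₂, h₁, h₂, hS, rfl, rfl⟩ := h.exists_split hwS
  obtain ⟨T₁, Q₁, T₂, Q₂, k₁, k₂, hT, rfl, rfl⟩ := h'.exists_split hwT
  have hu₁ := h₁.left_mem
  have hv₂ := h₂.right_mem
  have ku₁ := k₁.left_mem
  have kv₂ := k₂.right_mem
  rw [hG.eq_of_notMem (z := v) (by simp [he]) h₁ k₁ (by grind) (by grind) (by grind) (by grind),
    hG.eq_of_notMem (z := u) (by simp [he]) h₂ k₂ (by grind) (by grind) (by grind) (by grind)]

lemma CyclesMeetEnds.inter_eq (hG : G.CyclesMeetEnds e) (he : G.ends e = s(u, v))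
    (h : G.IsPathSet u v S P) (h' : G.IsPathSet u v T Q) (hP : e ∉ P) (hQ : e ∉ Q)
    (hPQ : P ≠ Q) : S ∩ T = {u, v} := by
  ext w
  constructor
  · intro hw
    obtain ⟨hwS, hwT⟩ := Finset.mem_inter.1 hw
    by_contra hne
    exact hPQ (hG.eq_of_inner_mem he h h' hP hQ hwS hwT (by grind) (by grind))
  · intro hw
    have := h.left_mem
    have := h.right_mem
    have := h'.left_mem
    have := h'.right_mem
    grind

lemma CyclesMeetEnds.disjoint (hG : G.CyclesMeetEnds e) (he : G.ends e = s(u, v))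
    (h : G.IsPathSet u v S P) (h' : G.IsPathSet u v T Q) (hP : e ∉ P) (hQ : e ∉ Q)
    (hPQ : P ≠ Q) : Disjoint P Q := by
  rw [Finset.disjoint_left]
  intro g hgP hgQ
  have hST := hG.inter_eq he h h' hP hQ hPQ
  have hends : ∀ z ∈ G.ends g, z = u ∨ z = v := by
    intro z hz
    have : z ∈ S ∩ T := Finset.mem_inter.2 ⟨h.mem_of_mem_ends hgP hz, h'.mem_of_mem_ends hgQ hz⟩
    simpa [hST] using this
  have hloop := h.not_isDiag hgP
  have hg : G.ends g = s(u, v) := by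
    induction hab : G.ends g with
    | _ a b =>
      have ha := hends a (by simp [hab])
      have hb := hends b (by simp [hab])
      rw [hab, Sym2.mk_isDiag_iff] at hloop
      rcases ha with rfl | rfl <;> rcases hb with rfl | rfl
      · exact absurd rfl hloop
      · rfl
      · exact Sym2.eq_swap
      · exact absurd rfl hloop
  exact hPQ ((h.eq_singleton hgP hg).trans (h'.eq_singleton hgQ hg).symm)

lemma reach_of_edgeConnected (hG : G.EdgeConnected 2) (hf : f ∈ G.E) (hx : x ∈ G.V)
    (hy : y ∈ G.V) : Relation.ReflTransGen (G.Link (G.E.erase f)) x y := by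
  have := (hG.2 {f} (by simpa) (by simp)).2 x hx y hy
  refine Relation.ReflTransGen.mono ?_ _ _ this
  rintro a b ⟨g, hg, hab⟩
  exact ⟨g, by simpa [deleteEdges, and_comm] using hg, hab⟩

/-- The arc through `f` of a cycle with vertices `u` and `v`. -/
lemma exists_isPathSet_mem_of_split (hf : f ∈ G.E) (hends : G.ends f = s(x, y)) (huv : u ≠ v)
    (he : G.ends e = s(u, v)) (hef : f ≠ e) (hv : v ∈ T) {S' P' : Finset ℕ}
    (h₁ : G.IsPathSet y u S' P') (h₂ : G.IsPathSet u x T Q) (hST : ∀ z ∈ S', z ∈ T → z = u) :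
    ∃ S P, G.IsPathSet u v S P ∧ e ∉ P ∧ f ∈ P := by
  obtain ⟨T₁, Q₁, T₂, Q₂, k₁, k₂, hT, rfl, rfl⟩ := h₂.exists_split hv
  have hu := k₁.left_mem
  have hy := h₁.left_mem
  have hv' := k₂.left_mem
  have hdisj : Disjoint S' T₂ := by
    rw [Finset.disjoint_left]
    grind
  have hx := k₂.right_mem
  have hxS : x ∉ S' := fun h => Finset.disjoint_left.1 hdisj h hx
  have hcons := IsPathSet.cons hf hends hxS h₁
  have := (k₂.append hcons (by
    have := @Finset.disjoint_left _ S' T₂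
    grind)).symm
  refine ⟨_, _, this, ?_, by grind⟩
  have e₁ : e ∉ P' := fun h => Finset.disjoint_left.1 hdisj
    (h₁.mem_of_mem_ends h (z := v) (by simp [he])) hv'
  have e₂ : e ∉ Q₂ := fun h => Finset.disjoint_left.1 hdisj h₁.right_mem
    (k₂.mem_of_mem_ends h (z := u) (by simp [he]))
  grind

lemma CyclesMeetEnds.exists_isPathSet_mem (hT : G.CyclesMeetEnds e) (hG : G.EdgeConnected 2)
    (he : G.ends e = s(u, v)) (huv : u ≠ v) (hf : f ∈ G.E) (hef : f ≠ e) :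
    ∃ S P, G.IsPathSet u v S P ∧ e ∉ P ∧ f ∈ P := by
  induction hends : G.ends f with
  | _ x y =>
    obtain ⟨hx, hy⟩ := mem_V_of_ends hf hends
    obtain ⟨S, P, h, hP⟩ := exists_isPathSet_of_reach (Finset.erase_subset f G.E) hx
      (reach_of_edgeConnected hG hf hy hx)
    have hends' : G.ends f = s(y, x) := hends.trans Sym2.eq_swap
    have hmem : ∀ z ∈ G.ends e, z ∈ S := by
      intro z hz
      by_cases heP : e ∈ P
      · exact h.mem_of_mem_ends heP hz
      · rw [← h.vertsOf_insert hends']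
        exact hT _ (h.isCycleSet_insert hf (by grind) hends') (by grind) z hz
    have hu := hmem u (by simp [he])
    have hv := hmem v (by simp [he])
    obtain ⟨S₁, P₁, S₂, P₂, h₁, h₂, hS, rfl, rfl⟩ := h.exists_split hu
    rcases Finset.mem_union.1 hv with hv | hv
    · exact exists_isPathSet_mem_of_split hf hends' huv he hef hv h₂.symm h₁.symm
        (fun z hz hz' => hS z hz' hz)
    · exact exists_isPathSet_mem_of_split hf hends huv he hef hv h₁ h₂ hS

lemma CyclesMeetEnds.isParallelConnOfCycles (hT : G.CyclesMeetEnds e) (hG : G.EdgeConnected 2)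
    (he : e ∈ G.E) (hloop : ¬ (G.ends e).IsDiag) : IsParallelConnOfCycles G e := by
  induction huv : G.ends e with
  | _ u v =>
    have hne : u ≠ v := by simpa [huv] using hloop
    obtain ⟨hu, hv⟩ := mem_V_of_ends he huv
    let F : Finset (Finset ℕ) := G.E.powerset.filter fun P => (∃ S, G.IsPathSet u v S P) ∧ e ∉ P
    have hF : ∀ {S P}, G.IsPathSet u v S P → e ∉ P → P ∈ F := fun h heP =>
      Finset.mem_filter.2 ⟨Finset.mem_powerset.2 h.subset_E, ⟨_, h⟩, heP⟩
    let A : Fin F.card → Finset ℕ := fun i => (F.equivFin.symm i).1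
    have hA : ∀ i, (∃ S, G.IsPathSet u v S (A i)) ∧ e ∉ A i := fun i =>
      (Finset.mem_filter.1 (F.equivFin.symm i).2).2
    have hAinj : Function.Injective A := Subtype.val_injective.comp F.equivFin.symm.injective
    have hAsurj : ∀ P ∈ F, ∃ i, A i = P := fun P hP => ⟨F.equivFin ⟨P, hP⟩, by simp [A]⟩
    choose S hS using fun i => (hA i).1
    have hverts : ∀ i, G.vertsOf (insert e (A i)) = S i := fun i => (hS i).vertsOf_insert huv
    have hpos : 0 < F.card := by
      obtain ⟨S, P, h, hP⟩ := exists_isPathSet_of_reach (Finset.erase_subset e G.E) hv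
        (reach_of_edgeConnected hG he hu hv)
      exact Finset.card_pos.2 ⟨P, hF h (by grind)⟩
    have hcover : ∀ f ∈ G.E, ∃ i, f ∈ insert e (A i) := by
      intro f hf
      by_cases hfe : f = e
      · exact ⟨⟨0, hpos⟩, by simp [hfe]⟩
      · obtain ⟨S, P, h, heP, hfP⟩ := hT.exists_isPathSet_mem hG huv hne hf hfe
        obtain ⟨i, rfl⟩ := hAsurj P (hF h heP)
        exact ⟨i, by simp [hfP]⟩
    refine ⟨u, v, hne, he, huv, F.card, fun i => insert e (A i), hpos, ?_, ?_, ?_, ?_⟩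
    · exact fun i => ⟨(hS i).isCycleSet_insert he (hA i).2 huv, by simp⟩
    · intro i j hij
      have hAij : A i ≠ A j := fun h => hij (hAinj h)
      constructor
      · rw [← Finset.insert_inter_distrib, Finset.disjoint_iff_inter_eq_empty.1
          (hT.disjoint huv (hS i) (hS j) (hA i).2 (hA j).2 hAij)]
        rfl
      · rw [hverts, hverts]
        exact hT.inter_eq huv (hS i) (hS j) (hA i).2 (hA j).2 hAij
    · ext f
      simp only [Finset.mem_biUnion, Finset.mem_univ, true_and]
      exact ⟨hcover f, fun ⟨i, hi⟩ => Finset.insert_subset he (hS i).subset_E hi⟩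
    · ext w
      simp only [Finset.mem_biUnion, Finset.mem_univ, true_and]
      constructor
      · intro hw
        rcases Relation.ReflTransGen.cases_tail (reach_of_edgeConnected hG he hu hw) with
          rfl | ⟨b, -, g, hg, hbw⟩
        · exact ⟨⟨0, hpos⟩, Finset.mem_filter.2 ⟨hw, e, by simp, by simp [huv]⟩⟩
        · obtain ⟨i, hi⟩ := hcover g (Finset.mem_of_mem_erase hg)
          exact ⟨i, Finset.mem_filter.2 ⟨hw, g, hi, by simp [hbw]⟩⟩
      · rintro ⟨i, hi⟩
        exact (Finset.mem_filter.1 hi).1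

lemma vertsOf_subset : G.vertsOf C ⊆ G.V := Finset.filter_subset _ _

lemma mem_vertsOf (hC : C ⊆ G.E) (hf : f ∈ C) (hz : z ∈ G.ends f) : z ∈ G.vertsOf C :=
  Finset.mem_filter.2 ⟨G.ends_mem f (hC hf) z hz, f, hf, hz⟩

lemma cmapOn_of_notMem {U : Finset ℕ} (hx : x ∉ U) : G.cmapOn U x = x := by
  simp [cmapOn, hx]

lemma cmapOn_mem {U : Finset ℕ} (hU : U ⊆ G.V) (hx : x ∈ U) : G.cmapOn U x ∈ U := by
  have hmem : sInf {w : ℕ | w ∈ U ∩ G.V} ∈ U ∩ G.V :=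
    Nat.sInf_mem ⟨x, Finset.mem_inter.2 ⟨hx, hU hx⟩⟩
  rw [cmapOn, if_pos (Finset.mem_inter.2 ⟨hx, hU hx⟩)]
  exact (Finset.mem_inter.1 hmem).1

lemma cmapOn_eq {U : Finset ℕ} (hU : U ⊆ G.V) (hx : x ∈ U) (hy : y ∈ U) :
    G.cmapOn U x = G.cmapOn U y := by
  simp [cmapOn, hx, hy, hU hx, hU hy]

lemma cmapOn_ne {U : Finset ℕ} (hU : U ⊆ G.V) (hx : x ∉ U) (hxy : x ≠ y) :
    G.cmapOn U x ≠ G.cmapOn U y := by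
  rw [cmapOn_of_notMem hx]
  by_cases hy : y ∈ U
  · exact fun h => hx (h ▸ cmapOn_mem hU hy)
  · rwa [cmapOn_of_notMem hy]

lemma contractCycle_E_card_lt (hC : G.IsCycleSet C) : (G.contractCycle C).E.card < G.E.card := by
  obtain ⟨f, hf⟩ := hC.1
  refine Finset.card_lt_card (Finset.filter_ssubset.2 ⟨f, hC.2.1 hf, ?_⟩)
  rintro (h | h)
  · exact h fun z hz => mem_vertsOf hC.2.1 hf hz
  · exact h.2 hf

/-- Contracting a cycle preserves connectivity, also after deleting further edges. -/
lemma connected_contractCycle_deleteEdges {Z : Finset ℕ} (h : (G.deleteEdges Z).Connected) :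
    ((G.contractCycle C).deleteEdges Z).Connected := by
  refine ⟨h.1.image _, ?_⟩
  intro a ha b hb
  obtain ⟨a, ha', rfl⟩ := Finset.mem_image.1 ha
  obtain ⟨b, hb', rfl⟩ := Finset.mem_image.1 hb
  have := h.2 a ha' b hb'
  clear hb ha hb' ha'
  induction this with
  | refl => exact .refl
  | @tail b c _ hbc ih =>
    refine ih.trans ?_
    obtain ⟨f, hf, hends⟩ := hbc
    obtain ⟨hfE, hfZ⟩ := Finset.mem_sdiff.1 hf
    change G.ends f = s(b, c) at hends
    by_cases hU : ∀ z ∈ G.ends f, z ∈ G.vertsOf C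
    · rw [cmapOn_eq vertsOf_subset (hU b (by simp [hends])) (hU c (by simp [hends]))]
    · refine .single ⟨f, Finset.mem_sdiff.2 ⟨Finset.mem_filter.2 ⟨hfE, Or.inl hU⟩, hfZ⟩, ?_⟩
      change (G.ends f).map (G.cmapOn (G.vertsOf C)) = _
      rw [hends, Sym2.map_mk]

lemma edgeConnected_contractCycle {k : ℕ} (hG : G.EdgeConnected k)
    (hV : 2 ≤ (G.contractCycle C).V.card) : (G.contractCycle C).EdgeConnected k :=
  ⟨hV, fun Z hZ hk => connected_contractCycle_deleteEdges
    (hG.2 Z (hZ.trans (Finset.filter_subset _ _)) hk)⟩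

lemma exists_ccMinor_cyclesMeetEnds (hG : G.EdgeConnected 2) (he : e ∈ G.E)
    (hloop : ¬ (G.ends e).IsDiag) :
    ∃ H, G.CCMinor H ∧ H.EdgeConnected 2 ∧ e ∈ H.E ∧ ¬ (H.ends e).IsDiag ∧
      H.CyclesMeetEnds e := by
  induction hn : G.E.card using Nat.strong_induction_on generalizing G with
  | _ n ih =>
    by_cases hT : G.CyclesMeetEnds e
    · exact ⟨G, .refl, hG, he, hloop, hT⟩
    · simp only [CyclesMeetEnds, not_forall] at hT
      obtain ⟨C, hC, -, u, hu, huC⟩ := hT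
      obtain ⟨v, huv⟩ := Sym2.mem_iff_exists.1 hu
      have hne : u ≠ v := by simpa [huv] using hloop
      have hcne := cmapOn_ne (G := G) (vertsOf_subset (C := C)) huC hne
      obtain ⟨huV, hvV⟩ := mem_V_of_ends he huv
      have hV : 2 ≤ (G.contractCycle C).V.card :=
        Finset.one_lt_card.2 ⟨_, Finset.mem_image_of_mem _ huV, _,
          Finset.mem_image_of_mem _ hvV, hcne⟩
      obtain ⟨H, hH, hH'⟩ := ih _ (hn ▸ contractCycle_E_card_lt hC)
        (edgeConnected_contractCycle hG hV)
        (Finset.mem_filter.2 ⟨he, Or.inl fun h => huC (h u hu)⟩)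
        (by
          change ¬ ((G.ends e).map (G.cmapOn (G.vertsOf C))).IsDiag
          rw [huv, Sym2.map_mk, Sym2.mk_isDiag_iff]
          exact hcne) rfl
      exact ⟨H, .head ⟨C, hC, rfl⟩ hH, hH'⟩

end MGraph

/-- Every 2-edge-connected graph `G` with a non-loop edge `e` has a cc-minor `H` that is
the parallel connection, with basepoint `e`, of a collection of cycles containing `e`. -/
theorem statement_7 (G : MGraph) (e : ℕ) (hG : G.EdgeConnected 2)
    (he : e ∈ G.E) (hloop : ¬ (G.ends e).IsDiag) :
    ∃ H, G.CCMinor H ∧ IsParallelConnOfCycles H e := by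
  obtain ⟨H, hH, hconn, heH, hloopH, hT⟩ := MGraph.exists_ccMinor_cyclesMeetEnds hG he hloop
  exact ⟨H, hH, hT.isParallelConnOfCycles hconn heH hloopH⟩
end
end

section
/- Let G be a 3-edge-connected graph, and let e be a non-loop edge of G. Then G has a cc-minor H that is a bond graph B_n containing e, for some n ≥ 3. -/
open scoped Classical

noncomputable section

namespace MGraph

/-- The number of times an edge with distinct ends `a`, `b` meets `x`. -/
lemma degIn_term {z : Sym2 ℕ} {a b : ℕ} (hz : z = s(a, b)) (hab : a ≠ b) (x : ℕ) :
    (if z = s(x, x) then 2 else if x ∈ z then 1 else 0) =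
      (if x = a then 1 else 0) + (if x = b then 1 else 0) := by
  subst hz
  have h : s(a, b) ≠ s(x, x) := by
    intro h
    rw [Sym2.eq_iff] at h
    grind
  rw [if_neg h]
  simp only [Sym2.mem_iff]
  grind

lemma degIn_insert (G : MGraph) {C : Finset ℕ} {f a b : ℕ} (hf : f ∉ C)
    (hends : G.ends f = s(a, b)) (hab : a ≠ b) (x : ℕ) :
    G.degIn (insert f C) x =
      ((if x = a then 1 else 0) + (if x = b then 1 else 0)) + G.degIn C x := by
  rw [degIn, Finset.sum_insert hf, degIn_term hends hab, degIn]

namespace IsWalk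

variable {G : MGraph}

lemma edge_mem {vs es : List ℕ} (h : G.IsWalk vs es) : ∀ f ∈ es, f ∈ G.E := by
  induction h with
  | nil hv => simp
  | cons he hends hw ih => simpa using ⟨he, ih⟩

lemma vert_mem {vs es : List ℕ} (h : G.IsWalk vs es) : ∀ x ∈ vs, x ∈ G.V := by
  induction h with
  | nil hv => simpa using hv
  | cons he hends hw ih =>
    intro x hx
    rcases List.mem_cons.mp hx with rfl | hx
    · exact G.ends_mem _ he _ (by simp [hends])
    · exact ih x hx

lemma mem_of_mem_ends {vs es : List ℕ} (h : G.IsWalk vs es) :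
    ∀ f ∈ es, ∀ x ∈ G.ends f, x ∈ vs := by
  induction h with
  | nil hv => simp
  | cons he hends hw ih =>
    intro f hf x hx
    rcases List.mem_cons.mp hf with rfl | hf
    · rw [hends, Sym2.mem_iff] at hx
      rcases hx with rfl | rfl <;> simp
    · exact List.mem_cons_of_mem _ (ih f hf x hx)

/-- In the edge set of a path every vertex has degree two, except that each end loses one. -/
lemma degIn_add {vs es : List ℕ} (h : G.IsWalk vs es) :
    vs.Nodup → ∀ a b, vs.head? = some a → vs.getLast? = some b → ∀ x,
    G.degIn es.toFinset x + (if x = a then 1 else 0) + (if x = b then 1 else 0) =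
      if x ∈ vs then 2 else 0 := by
  induction h with
  | nil hv =>
    intro _ a b ha hb x
    simp only [List.head?_cons, List.getLast?_singleton, Option.some.injEq] at ha hb
    subst ha hb
    simp only [degIn, List.toFinset_nil, Finset.sum_empty, List.mem_singleton]
    grind
  | @cons u v f vs es he hends hw ih =>
    intro hnd a b ha hb x
    rw [List.nodup_cons] at hnd
    simp only [List.head?_cons, Option.some.injEq] at ha
    subst ha
    rw [List.getLast?_cons_cons] at hb
    have huv : u ≠ v := fun h => hnd.1 (by simp [h])
    have hf : f ∉ es.toFinset := fun h =>
      hnd.1 (hw.mem_of_mem_ends f (List.mem_toFinset.mp h) u (by simp [hends]))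
    have := ih hnd.2 v b rfl hb x
    rw [List.toFinset_cons, degIn_insert G hf hends huv]
    have hux : x = u → x ∉ v :: vs := fun h => h ▸ hnd.1
    simp only [List.mem_cons (b := u)]
    grind

lemma reach_head {vs es : List ℕ} (h : G.IsWalk vs es) :
    ∀ a, vs.head? = some a → ∀ x ∈ vs,
    Relation.ReflTransGen (fun p q => ∃ f ∈ es, G.ends f = s(p, q)) a x := by
  induction h with
  | nil hv =>
    intro a ha x hx
    simp only [List.head?_cons, Option.some.injEq, List.mem_singleton] at ha hx
    subst ha hx
    exact .refl
  | @cons u v f vs es he hends hw ih =>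
    intro a ha x hx
    simp only [List.head?_cons, Option.some.injEq] at ha
    subst ha
    rcases List.mem_cons.mp hx with rfl | hx
    · exact .refl
    · refine .head ⟨f, by simp, hends⟩ (Relation.ReflTransGen.mono ?_ _ _ (ih v rfl x hx))
      rintro p q ⟨g, hg, hpq⟩
      exact ⟨g, List.mem_cons_of_mem _ hg, hpq⟩

/-- A path may be truncated at any of its vertices. -/
lemma exists_truncation {vs es : List ℕ} (h : G.IsWalk vs es) :
    vs.Nodup → ∀ y ∈ vs, ∃ vs' es', G.IsWalk vs' es' ∧ vs'.Nodup ∧ vs'.head? = vs.head? ∧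
      vs'.getLast? = some y ∧ vs' ⊆ vs ∧ es' ⊆ es := by
  induction h with
  | @nil v hv =>
    intro _ y hy
    obtain rfl := List.mem_singleton.mp hy
    exact ⟨[y], [], .nil hv, by simp, rfl, rfl, by simp, by simp⟩
  | @cons u v f vs es he hends hw ih =>
    intro hnd y hy
    rw [List.nodup_cons] at hnd
    by_cases hyu : y = u
    · subst hyu
      exact ⟨[y], [], .nil (G.ends_mem _ he _ (by simp [hends])), by simp, rfl, rfl,
        by simp, by simp⟩
    · obtain ⟨vs', es', hw', hnd', hhd, hlast, hsub, hsub'⟩ :=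
        ih hnd.2 y ((List.mem_cons.mp hy).resolve_left hyu)
      obtain _ | ⟨v', vs'⟩ := vs'
      · simp at hhd
      · obtain rfl : v' = v := by simpa using hhd
        refine ⟨u :: v' :: vs', f :: es', .cons he hends hw', ?_, rfl, ?_, ?_, ?_⟩
        · exact List.nodup_cons.mpr ⟨fun h => hnd.1 (hsub h), hnd'⟩
        · rw [List.getLast?_cons_cons, hlast]
        · exact List.cons_subset_cons _ hsub
        · exact List.cons_subset_cons _ hsub'

/-- A path together with a further edge joining its ends forms a cycle. -/
lemma isCycleSet {vs es : List ℕ} (h : G.IsWalk vs es) (hnd : vs.Nodup) {a b f : ℕ}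
    (ha : vs.head? = some a) (hb : vs.getLast? = some b) (hab : a ≠ b) (hf : f ∈ G.E)
    (hends : G.ends f = s(a, b)) (hfes : f ∉ es) :
    G.IsCycleSet (insert f es.toFinset) ∧ G.vertsOf (insert f es.toFinset) ⊆ vs.toFinset := by
  have hsub : G.vertsOf (insert f es.toFinset) ⊆ vs.toFinset := by
    intro x hx
    obtain ⟨-, g, hg, hxg⟩ := Finset.mem_filter.mp hx
    rw [List.mem_toFinset]
    rcases Finset.mem_insert.mp hg with rfl | hg
    · rw [hends, Sym2.mem_iff] at hxg
      rcases hxg with rfl | rfl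
      · exact List.mem_of_mem_head? ha
      · exact List.mem_of_getLast? hb
    · exact h.mem_of_mem_ends g (List.mem_toFinset.mp hg) x hxg
  refine ⟨⟨Finset.insert_nonempty _ _, ?_, ?_, ?_⟩, hsub⟩
  · intro g hg
    rcases Finset.mem_insert.mp hg with rfl | hg
    · exact hf
    · exact h.edge_mem g (List.mem_toFinset.mp hg)
  · intro x hx
    have hx' : x ∈ vs := List.mem_toFinset.mp (hsub hx)
    have := h.degIn_add hnd a b ha hb x
    rw [if_pos hx'] at this
    rw [degIn_insert G (by simpa using hfes) hends hab]
    omega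
  · have key : ∀ x ∈ vs, Relation.ReflTransGen
        (fun p q => ∃ g ∈ insert f es.toFinset, G.ends g = s(p, q)) a x := fun x hx => by
      refine Relation.ReflTransGen.mono ?_ _ _ (h.reach_head a ha x hx)
      rintro p q ⟨g, hg, hpq⟩
      exact ⟨g, by simp [hg], hpq⟩
    have hsymm : Std.Symm
        (fun p q => ∃ g ∈ insert f es.toFinset, G.ends g = s(p, q)) :=
      ⟨fun p q ⟨g, hg, hpq⟩ => ⟨g, hg, hpq.trans Sym2.eq_swap⟩⟩
    intro x hx y hy
    exact (Relation.ReflTransGen.stdSymm.symm _ _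
      (key x (List.mem_toFinset.mp (hsub hx)))).trans (key y (List.mem_toFinset.mp (hsub hy)))

end IsWalk

lemma isCycleSet_singleton_of_isDiag (G : MGraph) {f : ℕ} (hf : f ∈ G.E)
    (hd : (G.ends f).IsDiag) :
    G.IsCycleSet {f} ∧ ∃ x, G.vertsOf {f} ⊆ {x} := by
  obtain ⟨x, hx⟩ : ∃ x, G.ends f = s(x, x) := by
    generalize G.ends f = z at hd
    induction z with
    | _ a b => exact ⟨a, by rw [Sym2.mk_isDiag_iff.mp hd]⟩
  have hsub : G.vertsOf {f} ⊆ {x} := by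
    intro y hy
    obtain ⟨-, g, hg, hyg⟩ := Finset.mem_filter.mp hy
    rw [Finset.mem_singleton.mp hg, hx] at hyg
    simpa using hyg
  refine ⟨⟨Finset.singleton_nonempty f, by simpa using hf, ?_, ?_⟩, x, hsub⟩
  · intro y hy
    obtain rfl := Finset.mem_singleton.mp (hsub hy)
    simp [degIn, hx]
  · intro y hy z hz
    rw [Finset.mem_singleton.mp (hsub hy), Finset.mem_singleton.mp (hsub hz)]

lemma cmapOn_eq_cmapOn (G : MGraph) {U : Finset ℕ} {x y : ℕ} (hx : x ∈ G.V) (hy : y ∈ G.V)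
    (hxU : x ∈ U) (hyU : y ∈ U) : G.cmapOn U x = G.cmapOn U y := by
  simp [cmapOn, hx, hy, hxU, hyU]

lemma cmapOn_ne_cmapOn (G : MGraph) {U : Finset ℕ} {x y : ℕ} (hxy : x ≠ y)
    (h : ¬ (x ∈ U ∧ y ∈ U)) : G.cmapOn U x ≠ G.cmapOn U y := by
  have key : ∀ z ∈ U ∩ G.V, sInf {w : ℕ | w ∈ U ∩ G.V} ∈ U ∩ G.V := fun z hz =>
    Nat.sInf_mem (s := {w : ℕ | w ∈ U ∩ G.V}) ⟨z, hz⟩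
  unfold cmapOn
  split_ifs with h1 h2 h2
  · exact absurd ⟨(Finset.mem_inter.mp h1).1, (Finset.mem_inter.mp h2).1⟩ h
  · intro h3
    exact h2 (h3 ▸ key x h1)
  · intro h3
    exact h1 (h3 ▸ key y h2)
  · exact hxy

/-- Contracting a vertex set maps connections avoiding surviving edges to such connections. -/
lemma reach_contractOn (G : MGraph) (U S Z : Finset ℕ) {x y : ℕ}
    (h : (G.deleteEdges Z).Reach x y) :
    ((G.contractOn U S).deleteEdges Z).Reach (G.cmapOn U x) (G.cmapOn U y) := by
  induction h with
  | refl => exact .refl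
  | @tail p q _ hpq ih =>
    obtain ⟨f, hf, hends⟩ := hpq
    obtain ⟨hfE, hfZ⟩ := Finset.mem_sdiff.mp hf
    replace hends : G.ends f = s(p, q) := hends
    by_cases hU : ∀ v ∈ G.ends f, v ∈ U
    · have hp : p ∈ G.ends f := by simp [hends]
      have hq : q ∈ G.ends f := by simp [hends]
      rwa [← G.cmapOn_eq_cmapOn (G.ends_mem f hfE p hp) (G.ends_mem f hfE q hq)
        (hU p hp) (hU q hq)]
    · refine ih.tail ⟨f, Finset.mem_sdiff.mpr ⟨Finset.mem_filter.mpr ⟨hfE, Or.inl hU⟩, hfZ⟩, ?_⟩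
      change (G.ends f).map (G.cmapOn U) = _
      rw [hends, Sym2.map_mk]

/-- Contracting a vertex set preserves edge-connectivity as long as two vertices remain. -/
lemma EdgeConnected.contractOn {G : MGraph} {k : ℕ} (hG : G.EdgeConnected k) (U S : Finset ℕ)
    (hcard : 2 ≤ (G.contractOn U S).V.card) : (G.contractOn U S).EdgeConnected k := by
  refine ⟨hcard, fun Z hZ hk => ⟨Finset.card_pos.mp (Nat.zero_lt_two.trans_le hcard), ?_⟩⟩
  intro x hx y hy
  obtain ⟨x', hx', rfl⟩ := Finset.mem_image.mp hx
  obtain ⟨y', hy', rfl⟩ := Finset.mem_image.mp hy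
  exact G.reach_contractOn U S Z
    ((hG.2 Z (hZ.trans (Finset.filter_subset _ _)) hk).2 x' hx' y' hy')

/-- Contracting a cycle that does not span the edge `s(a, b)` keeps that edge as a non-loop. -/
lemma EdgeConnected.contractCycle {G : MGraph} {k e a b : ℕ} {C : Finset ℕ}
    (hG : G.EdgeConnected k) (he : e ∈ G.E) (hends : G.ends e = s(a, b)) (hab : a ≠ b)
    (hC : G.IsCycleSet C) (hU : ¬ (a ∈ G.vertsOf C ∧ b ∈ G.vertsOf C)) :
    (G.contractCycle C).EdgeConnected k ∧ e ∈ (G.contractCycle C).E ∧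
      ¬ ((G.contractCycle C).ends e).IsDiag ∧ (G.contractCycle C).E.card < G.E.card := by
  have hne := G.cmapOn_ne_cmapOn hab hU
  refine ⟨hG.contractOn _ _ ?_, ?_, ?_, ?_⟩
  · refine Finset.one_lt_card.mpr ⟨_, Finset.mem_image_of_mem _ (G.ends_mem e he a ?_),
      _, Finset.mem_image_of_mem _ (G.ends_mem e he b ?_), hne⟩ <;> simp [hends]
  · refine Finset.mem_filter.mpr ⟨he, Or.inl fun h => hU ⟨h a ?_, h b ?_⟩⟩ <;> simp [hends]
  · change ¬ ((G.ends e).map _).IsDiag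
    rwa [hends, Sym2.map_mk, Sym2.mk_isDiag_iff]
  · obtain ⟨f, hf⟩ := hC.1
    refine Finset.card_lt_card (Finset.filter_ssubset.mpr ⟨f, hC.2.1 hf, ?_⟩)
    rintro (h | h)
    · exact h fun v hv => Finset.mem_filter.mpr ⟨G.ends_mem f (hC.2.1 hf) v hv, f, hf, hv⟩
    · exact h.2 hf

/-- In a `k`-edge-connected graph every vertex meets at least `k` non-loop edges. -/
lemma EdgeConnected.le_card_incident {G : MGraph} {k x : ℕ} (hG : G.EdgeConnected k)
    (hx : x ∈ G.V) : k ≤ (G.E.filter (fun f => x ∈ G.ends f ∧ ¬ (G.ends f).IsDiag)).card := by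
  by_contra! hlt
  obtain ⟨y, hy, hyx⟩ := Finset.exists_mem_ne hG.1 x
  have hr := (hG.2 _ (Finset.filter_subset _ _) hlt).2 x hx y hy
  refine hyx ?_
  clear hy hyx
  induction hr with
  | refl => rfl
  | @tail p q _ hpq ih =>
    subst ih
    obtain ⟨f, hf, hends⟩ := hpq
    obtain ⟨hfE, hfZ⟩ := Finset.mem_sdiff.mp hf
    replace hends : G.ends f = s(p, q) := hends
    by_contra hqp
    refine hfZ (Finset.mem_filter.mpr ⟨hfE, by simp [hends], ?_⟩)
    rw [hends, Sym2.mk_isDiag_iff]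
    exact fun h => hqp h.symm

/-- A path avoiding `v` and not starting at `u` extends to one whose first vertex has all its
neighbours on the path or equal to `v`, provided the path cannot be extended to `u`. -/
lemma exists_maximal_walk (G : MGraph) {u v : ℕ} {w : ℕ} {l es : List ℕ}
    (hw : G.IsWalk (w :: l) es) (hnd : (w :: l).Nodup) (hv : v ∉ w :: l) (hwu : w ≠ u)
    (hu : u ∈ w :: l ∨ ∀ f ∈ G.E, ∀ y, G.ends f = s(u, y) → y = u ∨ y = v) :
    ∃ w' l' es', G.IsWalk (w' :: l') es' ∧ (w' :: l').Nodup ∧ v ∉ w' :: l' ∧ w' ≠ u ∧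
      ∀ f ∈ G.E, ∀ y, G.ends f = s(w', y) → y = v ∨ y ∈ w' :: l' := by
  induction hn : G.V.card - l.length using Nat.strong_induction_on generalizing w l es with
  | _ n ih =>
    by_cases hmax : ∀ f ∈ G.E, ∀ y, G.ends f = s(w, y) → y = v ∨ y ∈ w :: l
    · exact ⟨w, l, es, hw, hnd, hv, hwu, hmax⟩
    · push Not at hmax
      obtain ⟨f, hf, y, hends, hyv, hyl⟩ := hmax
      have hlen : (w :: l).length ≤ G.V.card := by
        rw [← List.toFinset_card_of_nodup hnd]
        exact Finset.card_le_card fun x hx => hw.vert_mem x (List.mem_toFinset.mp hx)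
      rw [List.length_cons] at hlen
      refine ih (G.V.card - (w :: l).length) ?_
        (.cons hf (hends.trans Sym2.eq_swap) hw) (List.nodup_cons.mpr ⟨hyl, hnd⟩)
        ?_ ?_ ?_ rfl
      · rw [List.length_cons]
        omega
      · rw [List.mem_cons]
        exact not_or.mpr ⟨hyv.symm, hv⟩
      · rintro rfl
        rcases hu with hu | hu
        · exact hyl hu
        · rcases hu f hf w (hends.trans Sym2.eq_swap) with rfl | rfl
          · exact hwu rfl
          · exact hv (by simp)
      · exact hu.imp_left (List.mem_cons_of_mem _)

/-- The edges of a path that meet its first vertex coincide. -/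
lemma IsWalk.eq_of_head_mem {G : MGraph} {w : ℕ} {l es : List ℕ} (hw : G.IsWalk (w :: l) es)
    (hnd : (w :: l).Nodup) {f g : ℕ} (hf : f ∈ es) (hg : g ∈ es) (hwf : w ∈ G.ends f)
    (hwg : w ∈ G.ends g) : f = g := by
  rw [List.nodup_cons] at hnd
  cases hw with
  | nil => simp at hf
  | @cons _ v e₀ vs es he hends hw =>
    have key : ∀ f ∈ e₀ :: es, w ∈ G.ends f → f = e₀ := fun f hf hwf =>
      (List.mem_cons.mp hf).resolve_right fun hf => hnd.1 (hw.mem_of_mem_ends f hf w hwf)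
    exact (key f hf hwf).trans (key g hg hwg).symm

/-- A 3-edge-connected graph on at least three vertices has, for any two distinct vertices, a
cycle that does not contain both. -/
lemma EdgeConnected.exists_isCycleSet {G : MGraph} (hG : G.EdgeConnected 3)
    (hcard : 3 ≤ G.V.card) {u v : ℕ} (huv : u ≠ v) :
    ∃ C, G.IsCycleSet C ∧ ¬ (u ∈ G.vertsOf C ∧ v ∈ G.vertsOf C) := by
  obtain ⟨w, l, es, hw, hnd, hv, hwu, hmax⟩ : ∃ w l es, G.IsWalk (w :: l) es ∧
      (w :: l).Nodup ∧ v ∉ w :: l ∧ w ≠ u ∧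
      ∀ f ∈ G.E, ∀ y, G.ends f = s(w, y) → y = v ∨ y ∈ w :: l := by
    by_cases hu : ∀ f ∈ G.E, ∀ y, G.ends f = s(u, y) → y = u ∨ y = v
    · obtain ⟨x, hx⟩ : (G.V \ {u, v}).Nonempty := by
        rw [← Finset.card_pos]
        have := Finset.le_card_sdiff {u, v} G.V
        have := Finset.card_le_two (a := u) (b := v)
        omega
      simp only [Finset.mem_sdiff, Finset.mem_insert, Finset.mem_singleton, not_or] at hx
      exact G.exists_maximal_walk (.nil hx.1) (by simp) (by simpa using Ne.symm hx.2.2) hx.2.1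
        (Or.inr hu)
    · push Not at hu
      obtain ⟨f, hf, y, hends, hyu, hyv⟩ := hu
      exact G.exists_maximal_walk
        (.cons hf (hends.trans Sym2.eq_swap) (.nil (G.ends_mem f hf u (by simp [hends]))))
        (by simpa using hyu) (by simp [hyv.symm, huv.symm]) hyu (Or.inl (by simp))
  have hwV : w ∈ G.V := hw.vert_mem w (by simp)
  have hwv : w ≠ v := fun h => hv (by simp [h])
  set F := G.E.filter (fun f => w ∈ G.ends f ∧ ¬ (G.ends f).IsDiag) with hF
  have hFc : 3 ≤ F.card := hG.le_card_incident hwV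
  by_cases hpar : ∃ f ∈ G.E, ∃ g ∈ G.E, f ≠ g ∧ G.ends f = s(w, v) ∧ G.ends g = s(w, v)
  · obtain ⟨f, hf, g, hg, hfg, hfe, hge⟩ := hpar
    obtain ⟨hC, hsub⟩ := (IsWalk.cons hf hfe (.nil (G.ends_mem f hf v (by simp [hfe])))).isCycleSet
      (by simpa using hwv) rfl rfl hwv hg hge (by simpa using hfg.symm)
    refine ⟨_, hC, fun h => ?_⟩
    have := hsub h.1
    simp [hwu.symm, huv] at this
  · obtain ⟨f, hfF, hfes, hfv⟩ : ∃ f ∈ F, f ∉ es ∧ G.ends f ≠ s(w, v) := by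
      by_contra! hno
      have h1 : (F.filter (· ∈ es)).card ≤ 1 := by
        refine Finset.card_le_one.mpr fun f hf g hg => ?_
        simp only [hF, Finset.mem_filter] at hf hg
        exact hw.eq_of_head_mem hnd hf.2 hg.2 hf.1.2.1 hg.1.2.1
      have h2 : (F.filter (· ∉ es)).card ≤ 1 := by
        refine Finset.card_le_one.mpr fun f hf g hg => ?_
        obtain ⟨hf, hf'⟩ := Finset.mem_filter.mp hf
        obtain ⟨hg, hg'⟩ := Finset.mem_filter.mp hg
        by_contra hfg
        exact hpar ⟨f, (Finset.mem_filter.mp hf).1, g, (Finset.mem_filter.mp hg).1, hfg,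
          hno f hf hf', hno g hg hg'⟩
      have := Finset.card_filter_add_card_filter_not (s := F) (· ∈ es)
      omega
    obtain ⟨hfE, hwf, hfd⟩ := Finset.mem_filter.mp hfF
    obtain ⟨y, hy⟩ := Sym2.mem_iff_exists.mp hwf
    have hwy : w ≠ y := by
      rwa [hy, Sym2.mk_isDiag_iff] at hfd
    have hyl : y ∈ w :: l := (hmax f hfE y hy).resolve_left fun h => hfv (h ▸ hy)
    obtain ⟨vs', es', hw', hnd', hhd, hlast, hsub, hsub'⟩ := hw.exists_truncation hnd y hyl
    obtain ⟨hC, hCs⟩ := hw'.isCycleSet hnd' hhd hlast hwy hfE hy fun h => hfes (hsub' h)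
    exact ⟨_, hC, fun h => hv (hsub (List.mem_toFinset.mp (hCs h.2)))⟩

/-- A loopless 3-edge-connected graph on two vertices is a bond graph. -/
lemma EdgeConnected.isBondGraph {G : MGraph} (hG : G.EdgeConnected 3) (hl : G.Loopless)
    (hcard : G.V.card = 2) : 3 ≤ G.E.card ∧ G.IsBondGraph G.E.card := by
  obtain ⟨u, v, huv, hV⟩ := Finset.card_eq_two.mp hcard
  refine ⟨(hG.le_card_incident (x := u) (by simp [hV])).trans
    (Finset.card_le_card (Finset.filter_subset _ _)), u, v, huv, hV, rfl, fun f hf => ?_⟩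
  have hd := hl f hf
  have hm := G.ends_mem f hf
  rw [hV] at hm
  generalize G.ends f = z at hd hm
  induction z with
  | _ a b =>
    rw [Sym2.mk_isDiag_iff] at hd
    have ha := hm a (by simp)
    have hb := hm b (by simp)
    simp only [Finset.mem_insert, Finset.mem_singleton] at ha hb
    rw [Sym2.eq_iff]
    grind

end MGraph

/-- Every 3-edge-connected graph `G` with a non-loop edge `e` has a cc-minor that is a bond
graph `B n`, for some `n ≥ 3`, containing the edge `e`. -/
theorem statement_8 (G : MGraph) (e : ℕ) (hG : G.EdgeConnected 3)
    (he : e ∈ G.E) (hloop : ¬ (G.ends e).IsDiag) :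
    ∃ H n, G.CCMinor H ∧ 3 ≤ n ∧ H.IsBondGraph n ∧ e ∈ H.E := by
  induction hn : G.E.card using Nat.strong_induction_on generalizing G with
  | _ n ih =>
    obtain ⟨a, b, hends⟩ : ∃ a b, G.ends e = s(a, b) := by
      induction G.ends e with
      | _ a b => exact ⟨a, b, rfl⟩
    have hab : a ≠ b := by
      rwa [hends, Sym2.mk_isDiag_iff] at hloop
    have step : ∀ C, G.IsCycleSet C → ¬ (a ∈ G.vertsOf C ∧ b ∈ G.vertsOf C) →
        ∃ H n, G.CCMinor H ∧ 3 ≤ n ∧ H.IsBondGraph n ∧ e ∈ H.E := by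
      intro C hC hU
      obtain ⟨hG', he', hloop', hlt⟩ := hG.contractCycle he hends hab hC hU
      obtain ⟨H, m, hH, hrest⟩ := ih _ (hn ▸ hlt) _ hG' he' hloop' rfl
      exact ⟨H, m, .head ⟨C, hC, rfl⟩ hH, hrest⟩
    by_cases hl : G.Loopless
    · by_cases hcard : G.V.card = 2
      · obtain ⟨h3, hbond⟩ := hG.isBondGraph hl hcard
        exact ⟨G, _, .refl, h3, hbond, he⟩
      · have := hG.1
        obtain ⟨C, hC, hU⟩ := hG.exists_isCycleSet (by omega) hab
        exact step C hC hU
    · unfold MGraph.Loopless at hl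
      push Not at hl
      obtain ⟨f, hf, hd⟩ := hl
      obtain ⟨hC, x, hx⟩ := G.isCycleSet_singleton_of_isDiag hf hd
      exact step _ hC fun h => hab
        ((Finset.mem_singleton.mp (hx h.1)).trans (Finset.mem_singleton.mp (hx h.2)).symm)
end
end
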